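/- Let G = (V,E) be a graph containing a clique K on at least three vertices such that every vertex of K has at most one neighbor in N(K) and every vertex of N(K) has exactly one neighbor in K, where N(K) is the set of vertices outside K adjacent to at least one vertex of K. Then the minimum size of a cluster editing set of G equals |N(K)| plus the minimum size of a cluster editing set of G[V ∖ K]; in particular, there is a minimum-size cluster editing set of G that contains all |N(K)| edges between K and N(K) (as deletions) and modifies no other pair involving a vertex of K. -/

import Mathlib

open SimpleGraph

/-- The graph obtained from `G` by applying the edge modification set `S`. -/
def editEdges {V : Type*} (G : SimpleGraph V) (S : Set (Sym2 V)) : SimpleGraph V :=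
  SimpleGraph.fromEdgeSet (symmDiff G.edgeSet S)

/-- A cluster graph: a disjoint union of cliques, equivalently a `P₃`-free graph. -/
def IsClusterGraph {V : Type*} (G : SimpleGraph V) : Prop :=
  ∀ u v w : V, G.Adj u v → G.Adj v w → u ≠ w → G.Adj u w

/-- `S` is a cluster editing set for `G`. -/
def IsClusterEditingSet {V : Type*} (G : SimpleGraph V) (S : Finset (Sym2 V)) : Prop :=
  (∀ e ∈ S, ¬ e.IsDiag) ∧ IsClusterGraph (editEdges G ↑S)

/-- `τ(G)`: the minimum size of a cluster editing set for `G`. -/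
noncomputable def clusterEditNum {V : Type*} [Fintype V] [DecidableEq V]
    (G : SimpleGraph V) : ℕ :=
  sInf {n | ∃ S : Finset (Sym2 V), IsClusterEditingSet G S ∧ S.card = n}

/-- `τ` of the subgraph of `G` induced by `W`. -/
noncomputable def clusterEditNumOn {V : Type*} [Fintype V] [DecidableEq V]
    (G : SimpleGraph V) (W : Finset V) : ℕ :=
  sInf {n | ∃ S : Finset (Sym2 V), (∀ e ∈ S, ¬ e.IsDiag) ∧
    (∀ e ∈ S, ∀ v ∈ e, v ∈ W) ∧ S.card = n ∧
    IsClusterGraph ((editEdges G ↑S).induce (W : Set V))}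

/-- `N(K)`: the set of vertices outside `K` that have a neighbor in `K`. -/
def nbrsOf {V : Type*} [Fintype V] [DecidableEq V]
    (G : SimpleGraph V) [DecidableRel G.Adj] (K : Finset V) : Finset V :=
  Finset.univ.filter (fun x => x ∉ K ∧ ∃ y ∈ K, G.Adj x y)

theorem editEdges_adj {V : Type*} (G : SimpleGraph V) (S : Set (Sym2 V)) (a b : V) :
    (editEdges G S).Adj a b ↔
      (G.Adj a b ∧ s(a, b) ∉ S ∨ s(a, b) ∈ S ∧ ¬ G.Adj a b) ∧ a ≠ b := by
  simp [editEdges, Set.mem_symmDiff]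

theorem exists_ne_self_and_iterate_two_ne_self {V : Type*} [DecidableEq V] (K : Finset V)
    (hK : 3 ≤ K.card) :
    ∃ f : V → V, ∀ u ∈ K, f u ∈ K ∧ f u ≠ u ∧ f (f u) ≠ u := by
  obtain ⟨m, hm⟩ := Nat.exists_eq_add_of_le' hK
  let e : K ≃ Fin (m + 3) := K.equivFinOfCardEq hm
  have h1 : ∀ i : Fin (m + 3), i + 1 ≠ i := by
    intro i h
    rw [add_eq_left] at h
    simp at h
  have h2 : ∀ i : Fin (m + 3), i + 1 + 1 ≠ i := by
    intro i h
    rw [add_assoc, add_eq_left] at h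
    have := congrArg Fin.val h
    rw [Fin.val_add] at this
    simp [Nat.mod_eq_of_lt] at this
  refine ⟨fun u => if h : u ∈ K then (e.symm (e ⟨u, h⟩ + 1) : V) else u, fun u hu => ?_⟩
  simp only [hu, dite_true, Finset.coe_mem, Subtype.coe_eta, Equiv.apply_symm_apply, true_and]
  constructor
  · intro h
    have h' : e.symm (e ⟨u, hu⟩ + 1) = ⟨u, hu⟩ := Subtype.ext h
    exact h1 _ ((Equiv.symm_apply_eq e).1 h')
  · intro h
    have h' : e.symm (e ⟨u, hu⟩ + 1 + 1) = ⟨u, hu⟩ := Subtype.ext h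
    exact h2 _ ((Equiv.symm_apply_eq e).1 h')

/-- Every induced `P₃` contains an edited pair. -/
theorem IsClusterEditingSet.mem_of_induced_path {V : Type*} {G : SimpleGraph V}
    {S : Finset (Sym2 V)} (hS : IsClusterEditingSet G S) {x u v : V}
    (hux : G.Adj u x) (huv : G.Adj u v) (hvx : ¬ G.Adj v x) (hne : v ≠ x) :
    s(u, x) ∈ S ∨ s(u, v) ∈ S ∨ s(v, x) ∈ S := by
  by_contra! h
  obtain ⟨h1, h2, h3⟩ := h
  have := hS.2 v u x
    ((editEdges_adj _ _ _ _).2 ⟨.inl ⟨huv.symm, by rwa [Sym2.eq_swap]⟩, huv.ne'⟩)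
    ((editEdges_adj _ _ _ _).2 ⟨.inl ⟨hux, h1⟩, hux.ne⟩) hne
  rw [editEdges_adj] at this
  simp_all

/-- A matching between a clique `K` and its neighbourhood forces one edited pair meeting `K` per
matching edge. -/
theorem IsClusterEditingSet.card_le_card_filter {V : Type*} [DecidableEq V] {G : SimpleGraph V}
    {S : Finset (Sym2 V)} (hS : IsClusterEditingSet G S) {K N : Finset V}
    [DecidablePred fun e : Sym2 V => ¬ ∀ v ∈ e, v ∉ K] (hK3 : 3 ≤ K.card)
    (hKclique : ∀ u ∈ K, ∀ v ∈ K, u ≠ v → G.Adj u v) (hdisj : ∀ x ∈ N, x ∉ K)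
    {p : V → V} (hp : ∀ x ∈ N, p x ∈ K) (hpadj : ∀ x ∈ N, ∀ u ∈ K, G.Adj u x ↔ u = p x)
    (hpinj : Set.InjOn p N) :
    N.card ≤ (S.filter (fun e => ¬ ∀ v ∈ e, v ∉ K)).card := by
  obtain ⟨f, hf⟩ := exists_ne_self_and_iterate_two_ne_self K hK3
  obtain ⟨k, -⟩ := Finset.card_pos.1 (by lia : 0 < K.card)
  have : Nonempty (Sym2 V) := ⟨s(k, k)⟩
  have key : ∀ x ∈ N, ∃ e ∈ S,
      e = s(p x, x) ∨ e = s(p x, f (p x)) ∨ e = s(f (p x), x) := by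
    intro x hx
    obtain ⟨hfK, hfne, -⟩ := hf _ (hp x hx)
    rcases hS.mem_of_induced_path ((hpadj x hx _ (hp x hx)).2 rfl)
      (hKclique _ (hp x hx) _ hfK hfne.symm) (fun h => hfne ((hpadj x hx _ hfK).1 h))
      (fun h => hdisj x hx (h ▸ hfK)) with h | h | h
    exacts [⟨_, h, .inl rfl⟩, ⟨_, h, .inr (.inl rfl)⟩, ⟨_, h, .inr (.inr rfl)⟩]
  choose! g hgS hg using key
  refine Finset.card_le_card_of_injOn g (fun x hx => ?_) (fun x hx y hy hxy => ?_)
  · have h1 := hp x hx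
    have h2 := (hf _ h1).1
    refine Finset.mem_coe.2 (Finset.mem_filter.2 ⟨hgS x hx, fun h => ?_⟩)
    rcases hg x hx with h' | h' | h' <;> rw [h'] at h <;> simp_all
  · have hpx := hp x hx
    have hpy := hp y hy
    have hfx := hf _ hpx
    have hfy := hf _ hpy
    have hxK := hdisj x hx
    have hyK := hdisj y hy
    have hinj := hpinj hx hy
    rcases hg x hx with h | h | h <;> rcases hg y hy with h' | h' | h' <;>
      rw [h, h', Sym2.eq_iff] at hxy <;> grind

theorem isClusterEditingSet_edgeFinset {V : Type*} [Fintype V] [DecidableEq V]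
    (G : SimpleGraph V) [DecidableRel G.Adj] : IsClusterEditingSet G G.edgeFinset := by
  refine ⟨fun e he => G.not_isDiag_of_mem_edgeFinset he, fun u v w huv => ?_⟩
  simp [editEdges] at huv

/-- Discarding the edited pairs that leave `W` edits the subgraph induced by `W`. -/
theorem IsClusterEditingSet.induce_filter {V : Type*} {G : SimpleGraph V}
    {S : Finset (Sym2 V)} (hS : IsClusterEditingSet G S) (W : Finset V)
    [DecidablePred fun e : Sym2 V => ∀ v ∈ e, v ∈ W] :
    IsClusterGraph
      ((editEdges G ↑(S.filter (fun e => ∀ v ∈ e, v ∈ W))).induce (W : Set V)) := by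
  have aux : ∀ a b : (W : Set V),
      ((editEdges G ↑(S.filter (fun e => ∀ v ∈ e, v ∈ W))).induce (W : Set V)).Adj a b ↔
        (editEdges G ↑S).Adj a b := by
    rintro ⟨a, ha⟩ ⟨b, hb⟩
    have ha' : a ∈ W := ha
    have hb' : b ∈ W := hb
    simp [editEdges_adj, ha', hb']
  intro u v w huv hvw hne
  rw [aux] at *
  exact hS.2 _ _ _ huv hvw (fun h => hne (Subtype.ext h))

/-- Separating the clique `K` from its neighbourhood and editing the rest yields a cluster
graph. -/
theorem isClusterEditingSet_union_image {V : Type*} [Fintype V] [DecidableEq V]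
    {G : SimpleGraph V} {K N : Finset V} {T : Finset (Sym2 V)} {p : V → V}
    (hKclique : ∀ u ∈ K, ∀ v ∈ K, u ≠ v → G.Adj u v)
    (hN : ∀ x, x ∈ N ↔ x ∉ K ∧ ∃ y ∈ K, G.Adj x y)
    (hp : ∀ x ∈ N, p x ∈ K) (hpadj : ∀ x ∈ N, ∀ u ∈ K, G.Adj u x ↔ u = p x)
    (hTdiag : ∀ e ∈ T, ¬ e.IsDiag) (hTK : ∀ e ∈ T, ∀ v ∈ e, v ∈ Kᶜ)
    (hT : IsClusterGraph ((editEdges G ↑T).induce ((Kᶜ : Finset V) : Set V))) :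
    IsClusterEditingSet G (T ∪ N.image (fun x => s(p x, x))) := by
  have hdisj : ∀ x ∈ N, x ∉ K := fun x hx => ((hN x).1 hx).1
  have hTK' : ∀ a b, s(a, b) ∈ T → a ∉ K ∧ b ∉ K := fun a b h =>
    ⟨Finset.mem_compl.1 (hTK _ h a (by simp)), Finset.mem_compl.1 (hTK _ h b (by simp))⟩
  have hcross : ∀ a ∈ K, ∀ b, b ∉ K →
      ¬ (editEdges G ↑(T ∪ N.image (fun x => s(p x, x)))).Adj a b := by
    intro a ha b hb h
    rw [editEdges_adj] at h
    rcases h.1 with ⟨hadj, hmem⟩ | ⟨hmem, hadj⟩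
    · have hbN : b ∈ N := (hN b).2 ⟨hb, a, ha, hadj.symm⟩
      refine hmem (Finset.mem_coe.2 (Finset.mem_union_right _ (Finset.mem_image.2 ⟨b, hbN, ?_⟩)))
      rw [(hpadj b hbN a ha).1 hadj]
    · rcases Finset.mem_union.1 (Finset.mem_coe.1 hmem) with h1 | h1
      · exact (hTK' _ _ h1).1 ha
      · obtain ⟨x, hx, hxe⟩ := Finset.mem_image.1 h1
        rcases Sym2.eq_iff.1 hxe with ⟨h2, h3⟩ | ⟨h2, h3⟩
        · subst h3
          exact hadj ((hpadj x hx a ha).2 h2.symm)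
        · exact hdisj x hx (h3 ▸ ha)
  have hin : ∀ a ∈ K, ∀ b ∈ K, a ≠ b →
      (editEdges G ↑(T ∪ N.image (fun x => s(p x, x)))).Adj a b := by
    intro a ha b hb hab
    refine (editEdges_adj _ _ _ _).2 ⟨.inl ⟨hKclique a ha b hb hab, fun hmem => ?_⟩, hab⟩
    rcases Finset.mem_union.1 (Finset.mem_coe.1 hmem) with h1 | h1
    · exact (hTK' _ _ h1).1 ha
    · obtain ⟨x, hx, hxe⟩ := Finset.mem_image.1 h1
      have := hdisj x hx
      rcases Sym2.eq_iff.1 hxe with ⟨h2, h3⟩ | ⟨h2, h3⟩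
      · exact this (h3 ▸ hb)
      · exact this (h3 ▸ ha)
  have hout : ∀ a b, a ∉ K → b ∉ K →
      ((editEdges G ↑(T ∪ N.image (fun x => s(p x, x)))).Adj a b ↔ (editEdges G ↑T).Adj a b) := by
    intro a b ha hb
    have : s(a, b) ∉ N.image (fun x => s(p x, x)) := by
      intro h1
      obtain ⟨x, hx, hxe⟩ := Finset.mem_image.1 h1
      have := hp x hx
      rcases Sym2.eq_iff.1 hxe with ⟨h2, h3⟩ | ⟨h2, h3⟩
      · exact ha (h2 ▸ this)
      · exact hb (h2 ▸ this)
    simp only [editEdges_adj, Finset.mem_coe, Finset.mem_union, this, or_false]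
  refine ⟨fun e he => ?_, fun u v w huv hvw hne => ?_⟩
  · rcases Finset.mem_union.1 he with h1 | h1
    · exact hTdiag e h1
    · obtain ⟨x, hx, rfl⟩ := Finset.mem_image.1 h1
      rw [Sym2.mk_isDiag_iff]
      exact fun h => hdisj x hx (h ▸ hp x hx)
  · by_cases hv : v ∈ K
    · have hu : u ∈ K := by_contra fun hu => hcross v hv u hu huv.symm
      have hw : w ∈ K := by_contra fun hw => hcross v hv w hw hvw
      exact hin u hu w hw hne
    · have hu : u ∉ K := fun hu => hcross u hu v hv huv
      have hw : w ∉ K := fun hw => hcross w hw v hv hvw.symm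
      rw [hout _ _ hu hv] at huv
      rw [hout _ _ hv hw] at hvw
      rw [hout _ _ hu hw]
      exact hT ⟨u, by simpa using hu⟩ ⟨v, by simpa using hv⟩ ⟨w, by simpa using hw⟩ huv hvw
        (fun h => hne (congrArg Subtype.val h))

/-- correctness of Rule 6 for Cluster Editing. If `G` contains a
clique `K` on at least three vertices such that every vertex of `K` has at most one
neighbor in `N(K)` and every vertex of `N(K)` has exactly one neighbor in `K`, then
`τ(G) = |N(K)| + τ(G[V ∖ K])`, and there is a minimum-size cluster editing set of `G`
containing all edges between `K` and `N(K)` (as deletions) and modifying no other pair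
involving a vertex of `K`. -/
theorem stmt13 {V : Type*} [Fintype V] [DecidableEq V]
    (G : SimpleGraph V) [DecidableRel G.Adj] (K : Finset V)
    (hK3 : 3 ≤ K.card)
    (hKclique : ∀ u ∈ K, ∀ v ∈ K, u ≠ v → G.Adj u v)
    (hKout : ∀ u ∈ K, (G.neighborFinset u ∩ nbrsOf G K).card ≤ 1)
    (hNin : ∀ x ∈ nbrsOf G K, (G.neighborFinset x ∩ K).card = 1) :
    clusterEditNum G = (nbrsOf G K).card + clusterEditNumOn G Kᶜ ∧
    ∃ S : Finset (Sym2 V), IsClusterEditingSet G S ∧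
      S.card = clusterEditNum G ∧
      (∀ u ∈ K, ∀ x : V, x ∉ K → G.Adj u x → s(u, x) ∈ S) ∧
      (∀ e ∈ S, ∀ a b : V, e = s(a, b) → a ∈ K → (b ∉ K ∧ G.Adj a b)) := by
  classical
  have hN : ∀ x, x ∈ nbrsOf G K ↔ x ∉ K ∧ ∃ y ∈ K, G.Adj x y := by simp [nbrsOf]
  have hpartner : ∀ x ∈ nbrsOf G K, ∃ u ∈ K, ∀ v ∈ K, G.Adj v x ↔ v = u := by
    intro x hx
    obtain ⟨u, hu⟩ := Finset.card_eq_one.1 (hNin x hx)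
    have hmem : ∀ v, G.Adj x v ∧ v ∈ K ↔ v = u := fun v => by
      simpa using Finset.ext_iff.1 hu v
    refine ⟨u, ((hmem u).2 rfl).2, fun v hv => ?_⟩
    rw [← hmem v, G.adj_comm]
    exact ⟨fun h => ⟨h, hv⟩, And.left⟩
  choose! p hpK hpadj using hpartner
  have hpinj : Set.InjOn p (nbrsOf G K) := by
    intro x hx y hy hxy
    refine Finset.card_le_one.1 (hKout _ (hpK x hx)) x ?_ y ?_
    · simpa using ⟨(hpadj x hx _ (hpK x hx)).2 rfl, hx⟩
    · simpa using ⟨(hpadj y hy _ (hpK x hx)).2 hxy, hy⟩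
  have hlower : ∀ S, IsClusterEditingSet G S →
      (nbrsOf G K).card + clusterEditNumOn G Kᶜ ≤ S.card := by
    intro S hS
    have h1 := hS.card_le_card_filter hK3 hKclique (fun x hx => ((hN x).1 hx).1) hpK hpadj hpinj
    have h2 : clusterEditNumOn G Kᶜ ≤ (S.filter (fun e => ∀ v ∈ e, v ∈ Kᶜ)).card :=
      Nat.sInf_le ⟨_, fun e he => hS.1 e (Finset.mem_filter.1 he).1,
        fun e he => (Finset.mem_filter.1 he).2, rfl, hS.induce_filter Kᶜ⟩
    have h3 := S.card_filter_add_card_filter_not (fun e => ∀ v ∈ e, v ∉ K)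
    simp only [Finset.mem_compl] at h2
    lia
  obtain ⟨T, hTdiag, hTK, hTcard, hT⟩ : clusterEditNumOn G Kᶜ ∈ {n | ∃ S : Finset (Sym2 V),
      (∀ e ∈ S, ¬ e.IsDiag) ∧ (∀ e ∈ S, ∀ v ∈ e, v ∈ Kᶜ) ∧ S.card = n ∧
      IsClusterGraph ((editEdges G ↑S).induce ((Kᶜ : Finset V) : Set V))} :=
    Nat.sInf_mem ⟨_, _, fun e he =>
      (isClusterEditingSet_edgeFinset G).1 e (Finset.mem_filter.1 he).1,
      fun e he => (Finset.mem_filter.1 he).2, rfl,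
      (isClusterEditingSet_edgeFinset G).induce_filter Kᶜ⟩
  have hS := isClusterEditingSet_union_image hKclique hN hpK hpadj hTdiag hTK hT
  have hScard : (T ∪ (nbrsOf G K).image (fun x => s(p x, x))).card ≤
      (nbrsOf G K).card + clusterEditNumOn G Kᶜ := by
    rw [add_comm, ← hTcard]
    exact (Finset.card_union_le _ _).trans (Nat.add_le_add_left Finset.card_image_le _)
  have hτ : clusterEditNum G = (nbrsOf G K).card + clusterEditNumOn G Kᶜ := by
    refine le_antisymm (le_trans (Nat.sInf_le ⟨_, hS, rfl⟩) hScard) ?_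
    refine le_csInf ⟨_, _, hS, rfl⟩ ?_
    rintro n ⟨S, hS', rfl⟩
    exact hlower S hS'
  refine ⟨hτ, _, hS, hτ ▸ le_antisymm hScard (hlower _ hS), fun u hu x hx hux => ?_, ?_⟩
  · have hxN : x ∈ nbrsOf G K := (hN x).2 ⟨hx, u, hu, hux.symm⟩
    rw [(hpadj x hxN u hu).1 hux]
    exact Finset.mem_union_right _ (Finset.mem_image_of_mem _ hxN)
  · rintro _ he a b rfl ha
    rcases Finset.mem_union.1 he with h1 | h1
    · exact absurd ha (Finset.mem_compl.1 (hTK _ h1 a (Sym2.mem_mk_left a b)))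
    · obtain ⟨x, hx, hxe⟩ := Finset.mem_image.1 h1
      have hxK := ((hN x).1 hx).1
      rcases Sym2.eq_iff.1 hxe with ⟨rfl, rfl⟩ | ⟨-, rfl⟩
      · exact ⟨hxK, (hpadj x hx _ ha).2 rfl⟩
      · exact absurd ha hxK
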